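/- arXiv:1909.03294 — 2 statements merged into one kernel-verified Lean document; each statement's English description precedes it below -/
import Mathlib

section
/- Let x be a rational number. Then F⁻(x) := bx/(1−2ax−x²) is an integer if and only if x = F⁻_n/F⁻_{n+1} for some n ≥ 0, or x = −F⁻_{n+1}/F⁻_n for some n ≥ 1. -/
/-- `Lm a n` : L⁻_0 = 1, L⁻_1 = a, L⁻_{n+2} = 2a L⁻_{n+1} + L⁻_n. -/
def Lm (a : ℤ) : ℕ → ℤ
  | 0 => 1
  | 1 => a
  | n + 2 => 2 * a * Lm a (n + 1) + Lm a n

/-- `Fm a b n` : F⁻_0 = 0, F⁻_1 = b, F⁻_{n+2} = 2a F⁻_{n+1} + F⁻_n. -/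
def Fm (a b : ℤ) : ℕ → ℤ
  | 0 => 0
  | 1 => b
  | n + 2 => 2 * a * Fm a b (n + 1) + Fm a b n

theorem Lm_Fm_succ {m a b : ℤ} (hab : a ^ 2 - m * b ^ 2 = -1) (n : ℕ) :
    Lm a (n + 1) = a * Lm a n + m * b * Fm a b n ∧
      Fm a b (n + 1) = b * Lm a n + a * Fm a b n := by
  induction n with
  | zero => simp [Lm, Fm]
  | succ n ih =>
    obtain ⟨hL, hF⟩ := ih
    simp only [Lm, Fm]
    constructor
    · linear_combination a * hL - m * b * hF + Lm a n * hab
    · linear_combination a * hF - b * hL + Fm a b n * hab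

theorem Lm_sq_sub_mul_Fm_sq {m a b : ℤ} (hab : a ^ 2 - m * b ^ 2 = -1) (n : ℕ) :
    Lm a n ^ 2 - m * Fm a b n ^ 2 = (-1) ^ n := by
  induction n with
  | zero => simp [Lm, Fm]
  | succ n ih =>
    obtain ⟨hL, hF⟩ := Lm_Fm_succ hab n
    rw [hL, hF, pow_succ]
    linear_combination (a ^ 2 - m * b ^ 2) * ih + (-1) ^ n * hab

theorem Lm_Fm_two_mul {m a b : ℤ} (hab : a ^ 2 - m * b ^ 2 = -1) (n : ℕ) :
    Lm a (2 * n) = Lm a n ^ 2 + m * Fm a b n ^ 2 ∧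
      Fm a b (2 * n) = 2 * Lm a n * Fm a b n := by
  induction n with
  | zero => simp [Lm, Fm]
  | succ n ih =>
    obtain ⟨h₁, h₂⟩ := ih
    obtain ⟨hL, hF⟩ := Lm_Fm_succ hab n
    obtain ⟨hL', hF'⟩ := Lm_Fm_succ hab (2 * n)
    obtain ⟨hL'', hF''⟩ := Lm_Fm_succ hab (2 * n + 1)
    rw [show 2 * (n + 1) = 2 * n + 1 + 1 by ring, hL'', hF'', hL', hF', h₁, h₂, hL, hF]
    constructor <;> ring

theorem Lm_two_mul_add_one {m a b : ℤ} (hab : a ^ 2 - m * b ^ 2 = -1) (n : ℕ) :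
    Lm a (2 * n + 1) = 2 * m * (Fm a b n * Fm a b (n + 1)) + (-1) ^ n * a := by
  obtain ⟨h₁, h₂⟩ := Lm_Fm_two_mul hab n
  rw [(Lm_Fm_succ hab (2 * n)).1, h₁, h₂, (Lm_Fm_succ hab n).2]
  linear_combination a * Lm_sq_sub_mul_Fm_sq hab n

theorem Fm_cassini (a b : ℤ) (n : ℕ) :
    Fm a b (n + 1) ^ 2 - 2 * a * Fm a b n * Fm a b (n + 1) - Fm a b n ^ 2 =
      (-1) ^ n * b ^ 2 := by
  induction n with
  | zero => simp [Fm]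
  | succ n ih =>
    simp only [Fm, pow_succ (-1 : ℤ) n] at ih ⊢
    linear_combination -ih

theorem dvd_Fm (a b : ℤ) : ∀ n, b ∣ Fm a b n
  | 0 => dvd_zero b
  | 1 => dvd_refl b
  | n + 2 => ((dvd_Fm a b (n + 1)).mul_left _).add (dvd_Fm a b n)

theorem Fm_succ_pos {a b : ℤ} (ha : 0 < a) (hb : 0 < b) : ∀ n, 0 < Fm a b (n + 1)
  | 0 => hb
  | 1 => by simp only [Fm]; positivity
  | n + 2 => by
    have h₁ := Fm_succ_pos ha hb (n + 1)
    have h₂ := Fm_succ_pos ha hb n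
    rw [Fm]
    positivity

/-- Every solution of `X ^ 2 - m * Y ^ 2 = ±1` with `0 < X` and `0 ≤ Y` is some `(Lm n, Fm n)`. -/
theorem exists_eq_Lm_Fm {m a b : ℤ} (hm : 0 < m) (ha : 0 < a) (hb : 0 < b)
    (hab : a ^ 2 - m * b ^ 2 = -1)
    (hmin : ∀ x y : ℤ, 0 < x → 0 < y →
      (x ^ 2 - m * y ^ 2 = 1 ∨ x ^ 2 - m * y ^ 2 = -1) → a ≤ x ∧ b ≤ y)
    {X Y : ℤ} (hX : 0 < X) (hY : 0 ≤ Y)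
    (hXY : X ^ 2 - m * Y ^ 2 = 1 ∨ X ^ 2 - m * Y ^ 2 = -1) :
    ∃ n, X = Lm a n ∧ Y = Fm a b n := by
  obtain rfl | hY := hY.eq_or_lt
  · refine ⟨0, ?_, rfl⟩
    rcases hXY with h | h
    · simp only [Lm]; nlinarith
    · nlinarith
  obtain ⟨hXa, hYb⟩ := hmin X Y hX hY hXY
  have hsq : a ^ 2 ≤ X ^ 2 := by gcongr
  have hmY : m * b ^ 2 ≤ m * Y ^ 2 := by gcongr
  have hX' : 0 < m * b * Y - a * X := by
    rw [sub_pos]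
    refine lt_of_pow_lt_pow_left₀ 2 (by positivity) ?_
    have e : (m * b * Y) ^ 2 = (a ^ 2 + 1) * (m * Y ^ 2) := by
      linear_combination -m * Y ^ 2 * hab
    rcases hXY with h | h
    · rw [e, show m * Y ^ 2 = X ^ 2 - 1 by linarith]; nlinarith
    · rw [e, show m * Y ^ 2 = X ^ 2 + 1 by linarith]; nlinarith
  have hY₀ : 0 ≤ b * X - a * Y := by
    rw [sub_nonneg]
    refine le_of_sq_le_sq ?_ (by positivity)
    refine le_of_mul_le_mul_left ?_ hm
    have e : m * (b * X) ^ 2 = (a ^ 2 + 1) * X ^ 2 := by linear_combination -X ^ 2 * hab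
    have e' : m * (a * Y) ^ 2 = a ^ 2 * (m * Y ^ 2) := by ring
    rcases hXY with h | h
    · rw [e, e', show m * Y ^ 2 = X ^ 2 - 1 by linarith]; nlinarith
    · rw [e, e', show m * Y ^ 2 = X ^ 2 + 1 by linarith]; nlinarith
  have hYlt : b * X - a * Y < Y := by
    suffices b * X < (a + 1) * Y by linarith
    refine lt_of_pow_lt_pow_left₀ 2 (by positivity) ?_
    refine lt_of_mul_lt_mul_left ?_ hm.le
    have e : m * (b * X) ^ 2 = (a ^ 2 + 1) * X ^ 2 := by linear_combination -X ^ 2 * hab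
    have e' : m * ((a + 1) * Y) ^ 2 = (a + 1) ^ 2 * (m * Y ^ 2) := by ring
    rcases hXY with h | h
    · rw [e, e', show m * Y ^ 2 = X ^ 2 - 1 by linarith]
      have : a * (a ^ 2 + 2) ≤ a * X ^ 2 := by gcongr; linarith
      nlinarith [mul_pos ha ha, mul_nonneg ha.le (sq_nonneg (a - 1))]
    · rw [e, e', show m * Y ^ 2 = X ^ 2 + 1 by linarith]
      have : 0 < a * X ^ 2 := by positivity
      nlinarith
  have hnorm : (m * b * Y - a * X) ^ 2 - m * (b * X - a * Y) ^ 2 = -(X ^ 2 - m * Y ^ 2) := by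
    linear_combination (X ^ 2 - m * Y ^ 2) * hab
  obtain ⟨n, hn₁, hn₂⟩ := exists_eq_Lm_Fm hm ha hb hab hmin hX' hY₀ (by
    rw [hnorm]
    rcases hXY with h | h <;> simp [h])
  obtain ⟨hL, hF⟩ := Lm_Fm_succ hab n
  refine ⟨n + 1, ?_, ?_⟩
  · rw [hL, ← hn₁, ← hn₂]
    linear_combination X * hab
  · rw [hF, ← hn₁, ← hn₂]
    linear_combination Y * hab
termination_by Y.toNat
decreasing_by omega

theorem isSquare_of_ratCast_sq {m : ℤ} {q : ℚ} (h : (m : ℚ) = q ^ 2) : IsSquare m :=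
  Rat.isSquare_intCast_iff.1 ⟨q, by rw [h, sq]⟩

theorem one_sub_two_mul_sub_sq_ne_zero {m a b : ℤ} (hns : ¬ IsSquare m) (hb : b ≠ 0)
    (hab : a ^ 2 - m * b ^ 2 = -1) (x : ℚ) : 1 - 2 * (a : ℚ) * x - x ^ 2 ≠ 0 := by
  intro h
  have hb' : (b : ℚ) ≠ 0 := mod_cast hb
  have hab' : (a : ℚ) ^ 2 - m * b ^ 2 = -1 := mod_cast hab
  refine hns (isSquare_of_ratCast_sq (q := (x + a) / b) ?_)
  field_simp
  linear_combination -hab' + h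

/-- If `k * x ^ 2 + (2 * a * k + b) * x - k = 0` has a rational root, then `b * k` is
`± Fm n * Fm (n + 1)`. -/
theorem exists_mul_eq_Fm_mul_Fm {m a b : ℤ} (hm : 0 < m) (hns : ¬ IsSquare m)
    (ha : 0 < a) (hb : 0 < b) (hab : a ^ 2 - m * b ^ 2 = -1)
    (hmin : ∀ x y : ℤ, 0 < x → 0 < y →
      (x ^ 2 - m * y ^ 2 = 1 ∨ x ^ 2 - m * y ^ 2 = -1) → a ≤ x ∧ b ≤ y)
    {x : ℚ} {k : ℤ} (h : (b : ℚ) * x = k * (1 - 2 * a * x - x ^ 2)) :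
    ∃ n, b * k = (-1) ^ n * (Fm a b n * Fm a b (n + 1)) := by
  obtain ⟨D, hD⟩ : IsSquare ((2 * a * k + b) ^ 2 + 4 * k ^ 2) := by
    refine isSquare_of_ratCast_sq (q := 2 * k * x + (2 * a * k + b)) ?_
    push_cast
    linear_combination -4 * k * h
  have hpell : (2 * m * b * k + a) ^ 2 - m * D ^ 2 = -1 := by
    linear_combination (1 - 4 * m * k ^ 2) * hab + m * hD
  have hm1 : m ≠ 1 := by
    rintro rfl
    exact hns IsSquare.one
  have not_dvd : ¬ m ∣ a := by
    intro hma
    have : m ∣ 1 := by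
      rw [show (1 : ℤ) = m * b ^ 2 - a * a by linear_combination hab]
      exact (dvd_mul_right m _).sub (hma.mul_right a)
    exact hm1 (Int.eq_one_of_dvd_one hm.le this)
  have hX : 2 * m * b * k + a ≠ 0 := fun h0 => not_dvd ⟨-(2 * b * k), by linear_combination h0⟩
  obtain ⟨N, hN₁, hN₂⟩ := exists_eq_Lm_Fm hm ha hb hab hmin (abs_pos.2 hX) (abs_nonneg D)
    (by rw [sq_abs, sq_abs]; exact .inr hpell)
  have hodd : Odd N := by
    have := Lm_sq_sub_mul_Fm_sq hab N
    rw [← hN₁, ← hN₂, sq_abs, sq_abs, hpell] at this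
    by_contra hN
    rw [Nat.not_odd_iff_even] at hN
    rw [hN.neg_one_pow] at this
    omega
  obtain ⟨n, rfl⟩ := hodd
  rw [Lm_two_mul_add_one hab] at hN₁
  refine ⟨n, ?_⟩
  have hcancel : ∀ u v : ℤ, 2 * m * u = 2 * m * v → u = v := fun u v huv =>
    mul_left_cancel₀ (by positivity) huv
  have hdvd : ∀ u : ℤ, 2 * m * u = 2 * a → False := fun u hu => not_dvd ⟨u, by linarith⟩
  rcases neg_one_pow_eq_or ℤ n with hs | hs <;> rw [hs] at hN₁ ⊢ <;>
    rcases abs_choice (2 * m * b * k + a) with hc | hc <;> rw [hc] at hN₁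
  · exact hcancel _ _ (by linear_combination hN₁)
  · exact (hdvd (-(Fm a b n * Fm a b (n + 1)) - b * k) (by linear_combination hN₁)).elim
  · exact (hdvd (Fm a b n * Fm a b (n + 1) - b * k) (by linear_combination -hN₁)).elim
  · exact hcancel _ _ (by linear_combination -hN₁)

theorem F_minus_int_iff (m a b : ℤ) (hm : 0 < m) (hns : ¬ IsSquare m)
    (ha : 0 < a) (hb : 0 < b) (hab : a ^ 2 - m * b ^ 2 = -1)
    (hmin : ∀ x y : ℤ, 0 < x → 0 < y →
      (x ^ 2 - m * y ^ 2 = 1 ∨ x ^ 2 - m * y ^ 2 = -1) → a ≤ x ∧ b ≤ y)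
    (x : ℚ) :
    (∃ k : ℤ, ((b : ℚ) * x) / (1 - 2 * (a : ℚ) * x - x ^ 2) = (k : ℚ)) ↔
      ((∃ n : ℕ, x = (Fm a b n : ℚ) / (Fm a b (n + 1) : ℚ)) ∨
       (∃ n : ℕ, 1 ≤ n ∧ x = -((Fm a b (n + 1) : ℚ) / (Fm a b n : ℚ)))) := by
  have hden := one_sub_two_mul_sub_sq_ne_zero hns hb.ne' hab x
  have hb' : (b : ℚ) ≠ 0 := mod_cast hb.ne'
  have hcas (n : ℕ) : (Fm a b (n + 1) : ℚ) ^ 2 - 2 * a * Fm a b n * Fm a b (n + 1)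
      - Fm a b n ^ 2 = (-1) ^ n * b ^ 2 := mod_cast Fm_cassini a b n
  have hpos (n : ℕ) : (Fm a b (n + 1) : ℚ) ≠ 0 := mod_cast (Fm_succ_pos ha hb n).ne'
  have hsign (n : ℕ) : ((-1 : ℚ) ^ n) * (-1) ^ n = 1 := by rw [← mul_pow]; simp
  have hroot (n : ℕ) (k : ℤ) (hk : b * k = (-1) ^ n * (Fm a b n * Fm a b (n + 1))) :
      (b : ℚ) * x / (1 - 2 * a * x - x ^ 2) = k ↔
        (Fm a b n * x + Fm a b (n + 1)) * (Fm a b (n + 1) * x - Fm a b n) = 0 := by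
    have hk' : (b : ℚ) * k = (-1) ^ n * (Fm a b n * Fm a b (n + 1)) := mod_cast hk
    have hfactor : (b : ℚ) * (b * x - k * (1 - 2 * a * x - x ^ 2)) = (-1) ^ n *
        ((Fm a b n * x + Fm a b (n + 1)) * (Fm a b (n + 1) * x - Fm a b n)) := by
      linear_combination -(1 - 2 * a * x - x ^ 2) * hk' - (-1) ^ n * x * hcas n
        - b ^ 2 * x * hsign n
    rw [div_eq_iff hden, ← sub_eq_zero, ← mul_eq_zero_iff_left hb', hfactor]
    simp
  have hint (n : ℕ) : ∃ k : ℤ, b * k = (-1) ^ n * (Fm a b n * Fm a b (n + 1)) := by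
    obtain ⟨k, hk⟩ := ((dvd_Fm a b n).mul_right (Fm a b (n + 1))).mul_left ((-1) ^ n)
    exact ⟨k, hk.symm⟩
  constructor
  · rintro ⟨k, hk⟩
    obtain ⟨n, hn⟩ := exists_mul_eq_Fm_mul_Fm hm hns ha hb hab hmin ((div_eq_iff hden).1 hk)
    rcases mul_eq_zero.1 ((hroot n k hn).1 hk) with h | h
    · cases n with
      | zero => exact absurd (by simpa [Fm] using h) (hpos 0)
      | succ n =>
        refine .inr ⟨n + 1, by omega, ?_⟩
        have := hpos n
        field_simp
        linear_combination h
    · refine .inl ⟨n, ?_⟩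
      rw [eq_div_iff (hpos n)]
      linear_combination h
  · rintro (⟨n, hx⟩ | ⟨n, hn, hx⟩) <;> obtain ⟨k, hk⟩ := hint n <;>
      refine ⟨k, (hroot n k hk).2 (mul_eq_zero.2 ?_)⟩
    · right
      rw [hx, mul_div_cancel₀ _ (hpos n), sub_self]
    · left
      obtain ⟨n, rfl⟩ := Nat.exists_eq_succ_of_ne_zero (by omega : n ≠ 0)
      rw [hx, mul_neg, mul_div_cancel₀ _ (hpos n), neg_add_cancel]
end

section
/- Let x be a rational number with |x| < 1/(a + b√m). Then L⁺(x) := (1−ax)/(1−2ax+x²) is an integer if and only if x = F⁺_n/F⁺_{n+1} for some n ≥ 0. -/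
/-- `Lp a n` = ((a+b√m)^n + (a-b√m)^n)/2 : L⁺_0 = 1, L⁺_1 = a, L⁺_{n+2} = 2a L⁺_{n+1} - L⁺_n. -/
def Lp (a : ℤ) : ℕ → ℤ
  | 0 => 1
  | 1 => a
  | n + 2 => 2 * a * Lp a (n + 1) - Lp a n

/-- `Fp a b n` : F⁺_0 = 0, F⁺_1 = b, F⁺_{n+2} = 2a F⁺_{n+1} - F⁺_n. -/
def Fp (a b : ℤ) : ℕ → ℤ
  | 0 => 0
  | 1 => b
  | n + 2 => 2 * a * Fp a b (n + 1) - Fp a b n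

theorem Fp_eq_mul (a b : ℤ) (n : ℕ) : Fp a b n = b * Fp a 1 n := by
  induction n using Nat.twoStepInduction with
  | zero => simp [Fp]
  | one => simp [Fp]
  | more n h₀ h₁ => rw [Fp, Fp, h₀, h₁]; ring

theorem Lp_Fp_succ {m a b : ℤ} (hab : a ^ 2 - m * b ^ 2 = 1) (n : ℕ) :
    Lp a (n + 1) = a * Lp a n + m * b * Fp a b n ∧
      Fp a b (n + 1) = b * Lp a n + a * Fp a b n := by
  induction n with
  | zero => simp [Lp, Fp]
  | succ n ih =>
    obtain ⟨hL, hF⟩ := ih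
    constructor
    · rw [Lp, hF, hL]
      linear_combination Lp a n * hab
    · rw [Fp, hF, hL]
      linear_combination Fp a b n * hab

theorem Lp_sq_sub_mul_Fp_sq {m a b : ℤ} (hab : a ^ 2 - m * b ^ 2 = 1) (n : ℕ) :
    Lp a n ^ 2 - m * Fp a b n ^ 2 = 1 := by
  induction n with
  | zero => simp [Lp, Fp]
  | succ n ih =>
    rw [(Lp_Fp_succ hab n).1, (Lp_Fp_succ hab n).2]
    linear_combination (a ^ 2 - m * b ^ 2) * ih + hab

theorem Lp_pos_Fp_nonneg {m a b : ℤ} (hm : 0 < m) (ha : 0 < a) (hb : 0 < b)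
    (hab : a ^ 2 - m * b ^ 2 = 1) (n : ℕ) : 0 < Lp a n ∧ 0 ≤ Fp a b n := by
  induction n with
  | zero => simp [Lp, Fp]
  | succ n ih =>
    obtain ⟨hL, hF⟩ := ih
    rw [(Lp_Fp_succ hab n).1, (Lp_Fp_succ hab n).2]
    constructor <;> positivity

theorem odd_Fp_one_odd (a : ℤ) (k : ℕ) : Odd (Fp a 1 (2 * k + 1)) := by
  induction k with
  | zero => simp [Fp]
  | succ k ih =>
    rw [show 2 * (k + 1) + 1 = (2 * k + 1) + 2 by ring, Fp, mul_assoc]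
    exact (even_two_mul _).sub_odd ih

theorem Lp_Fp_two_mul {m a b : ℤ} (hab : a ^ 2 - m * b ^ 2 = 1) (k : ℕ) :
    Lp a (2 * k) = Lp a k ^ 2 + m * Fp a b k ^ 2 ∧ Fp a b (2 * k) = 2 * Lp a k * Fp a b k := by
  induction k with
  | zero => simp [Lp, Fp]
  | succ k ih =>
    rw [show 2 * (k + 1) = 2 * k + 1 + 1 by ring, (Lp_Fp_succ hab (2 * k + 1)).1,
      (Lp_Fp_succ hab (2 * k + 1)).2, (Lp_Fp_succ hab (2 * k)).1, (Lp_Fp_succ hab (2 * k)).2,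
      ih.1, ih.2, (Lp_Fp_succ hab k).1, (Lp_Fp_succ hab k).2]
    constructor <;> ring

/-- Every nonnegative solution of the Pell equation is one of the pairs `(Lp a n, Fp a b n)`. -/
theorem exists_eq_Lp_Fp {m a b : ℤ} (hm : 0 < m) (ha : 0 < a) (hb : 0 < b)
    (hab : a ^ 2 - m * b ^ 2 = 1)
    (hmin : ∀ x y : ℤ, 0 < x → 0 < y → x ^ 2 - m * y ^ 2 = 1 → a ≤ x)
    {x y : ℤ} (hx : 0 < x) (hy : 0 ≤ y) (h : x ^ 2 - m * y ^ 2 = 1) :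
    ∃ n : ℕ, x = Lp a n ∧ y = Fp a b n := by
  let e : Pell.Solution₁ m := Pell.Solution₁.mk a b hab
  have he : Pell.IsFundamental e := by
    refine ⟨?_, ?_, fun {s} hs => ?_⟩
    · have : 0 < m * b ^ 2 := by positivity
      simp only [e, Pell.Solution₁.x_mk]
      nlinarith
    · simpa [e] using hb
    · have hs' := s.prop
      have hy : s.y ≠ 0 := fun h0 => by
        rw [h0] at hs'
        nlinarith
      simp only [e, Pell.Solution₁.x_mk]
      exact hmin s.x |s.y| (by linarith) (abs_pos.mpr hy) (by rwa [sq_abs])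
  have hpow (n : ℕ) : (e ^ n).x = Lp a n ∧ (e ^ n).y = Fp a b n := by
    induction n with
    | zero => simp [Lp, Fp]
    | succ n ih =>
      rw [pow_succ, Pell.Solution₁.x_mul, Pell.Solution₁.y_mul, ih.1, ih.2,
        (Lp_Fp_succ hab n).1, (Lp_Fp_succ hab n).2]
      simp only [e, Pell.Solution₁.x_mk, Pell.Solution₁.y_mk]
      constructor <;> ring
  obtain ⟨n, hn⟩ := he.eq_pow_of_nonneg (a := Pell.Solution₁.mk x y h) (by simpa using hx)
    (by simpa using hy)
  refine ⟨n, ?_, ?_⟩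
  · rw [← (hpow n).1, ← hn, Pell.Solution₁.x_mk]
  · rw [← (hpow n).2, ← hn, Pell.Solution₁.y_mk]

/-- For a minimal solution `(a, b)` with `D * E = m * b ^ 2`, the equation
`D * t ^ 2 - E * p ^ 2 = 1` is solvable with `D` prime to `p ≠ 0` only for `D = 1`. -/
theorem eq_one_of_mul_sq_sub_mul_sq {m a b : ℤ} (hm : 0 < m) (ha : 0 < a) (hb : 0 < b)
    (hab : a ^ 2 - m * b ^ 2 = 1)
    (hmin : ∀ x y : ℤ, 0 < x → 0 < y → x ^ 2 - m * y ^ 2 = 1 → a ≤ x)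
    {D E t p : ℤ} (hD : 0 < D) (ht : 0 < t) (hDE : m * b ^ 2 = D * E)
    (hDp : IsCoprime D p) (h : D * t ^ 2 - E * p ^ 2 = 1) : D = 1 := by
  have hDt : 0 < D * t ^ 2 := by positivity
  obtain ⟨n, hx, hy⟩ := exists_eq_Lp_Fp hm ha hb hab hmin
    (x := 2 * (D * t ^ 2) - 1) (y := 2 * t * |p| * b) (by linarith) (by positivity) (by
      rw [mul_pow, mul_pow, sq_abs]
      linear_combination (4 * D * t ^ 2) * h - 4 * t ^ 2 * p ^ 2 * hDE)
  rcases Nat.even_or_odd' n with ⟨k, rfl | rfl⟩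
  · rw [(Lp_Fp_two_mul hab k).1] at hx
    rw [(Lp_Fp_two_mul hab k).2, Fp_eq_mul] at hy
    have hL : D * t ^ 2 = Lp a k ^ 2 := by
      linarith [Lp_sq_sub_mul_Fp_sq hab k]
    have hU : t * |p| = Lp a k * Fp a 1 k :=
      mul_left_cancel₀ (mul_pos two_pos hb).ne' (by linear_combination hy)
    have hp : p ^ 2 = D * Fp a 1 k ^ 2 := by
      refine mul_left_cancel₀ (pow_pos ht 2).ne' ?_
      rw [← sq_abs p]
      linear_combination (t * |p| + Lp a k * Fp a 1 k) * hU - Fp a 1 k ^ 2 * hL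
    have hu : IsUnit D := hDp.pow_right.isUnit_of_dvd' dvd_rfl ⟨_, hp⟩
    rcases Int.isUnit_iff.mp hu with h1 | h1 <;> omega
  · rw [Fp_eq_mul] at hy
    have hU : Fp a 1 (2 * k + 1) = 2 * (t * |p|) :=
      mul_left_cancel₀ hb.ne' (by linear_combination -hy)
    exact absurd (hU ▸ even_two_mul _) (Int.not_even_iff_odd.mpr (odd_Fp_one_odd a k))

theorem exists_eq_div_Fp_of_dvd {m a b : ℤ} (hm : 0 < m) (ha : 0 < a) (hb : 0 < b)
    (hab : a ^ 2 - m * b ^ 2 = 1)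
    (hmin : ∀ x y : ℤ, 0 < x → 0 < y → x ^ 2 - m * y ^ 2 = 1 → a ≤ x)
    {p q : ℤ} (hpq : IsCoprime p q) (hq : 0 < q) (hD : 0 < q ^ 2 - 2 * a * p * q + p ^ 2)
    (hN : 0 < q - a * p) (hdvd : q ^ 2 - 2 * a * p * q + p ^ 2 ∣ q * (q - a * p)) :
    ∃ n : ℕ, b * p = Fp a b n ∧ b * q = Fp a b (n + 1) := by
  obtain ⟨D, hDdef⟩ : ∃ D, D = q ^ 2 - 2 * a * p * q + p ^ 2 := ⟨_, rfl⟩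
  rw [← hDdef] at hD hdvd
  have hDq : IsCoprime D q := by
    rw [hDdef, show q ^ 2 - 2 * a * p * q + p ^ 2 = p ^ 2 + q * (q - 2 * a * p) by ring]
    exact (IsCoprime.add_mul_left_left_iff).mpr hpq.pow_left
  have hDp : IsCoprime D p := by
    rw [hDdef, show q ^ 2 - 2 * a * p * q + p ^ 2 = q ^ 2 + p * (p - 2 * a * q) by ring]
    exact (IsCoprime.add_mul_left_left_iff).mpr hpq.symm.pow_left
  obtain ⟨t, ht⟩ := hDq.dvd_of_dvd_mul_left hdvd
  have ht0 : 0 < t := pos_of_mul_pos_right (ht ▸ hN) hD.le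
  have hfac : D * (D * t ^ 2 - 1) = m * b ^ 2 * p ^ 2 := by
    linear_combination (-(D * t) - (q - a * p)) * ht + p ^ 2 * hab - hDdef
  obtain ⟨E, hE⟩ : D ∣ m * b ^ 2 :=
    (hDp.pow_right (n := 2)).dvd_of_dvd_mul_right ⟨_, hfac.symm⟩
  have hDE : D * t ^ 2 - E * p ^ 2 = 1 := by
    have : D * t ^ 2 - 1 = E * p ^ 2 :=
      mul_left_cancel₀ hD.ne' (by linear_combination hfac + p ^ 2 * hE)
    linarith
  obtain rfl : D = 1 := eq_one_of_mul_sq_sub_mul_sq hm ha hb hab hmin hD ht0 hE hDp hDE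
  obtain ⟨n, hL, hF⟩ := exists_eq_Lp_Fp hm ha hb hab hmin (x := t) (y := b * |p|) ht0
    (by positivity) (by rw [mul_pow, sq_abs]; linear_combination hDE - p ^ 2 * hE)
  rcases le_or_gt 0 p with hp | hp
  · rw [abs_of_nonneg hp] at hF
    refine ⟨n, hF, ?_⟩
    rw [(Lp_Fp_succ hab n).2, ← hL, ← hF]
    linear_combination b * ht
  · exfalso
    rw [abs_of_neg hp] at hF
    cases n with
    | zero =>
      simp only [Fp] at hF
      nlinarith
    | succ n =>
      have hrec : b * q = -Fp a b n := by
        rw [(Lp_Fp_succ hab n).1] at hL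
        rw [(Lp_Fp_succ hab n).2] at hF
        linear_combination b * ht + b * hL - a * hF - Fp a b n * hab
      have := (Lp_pos_Fp_nonneg hm ha hb hab n).2
      nlinarith

theorem pos_of_abs_lt_inv {a s x : ℝ} (ha : 0 < a) (hs : 0 ≤ s) (h : a ^ 2 - s ^ 2 = 1)
    (hx : |x| < 1 / (a + s)) : 0 < 1 - 2 * a * x + x ^ 2 ∧ 0 < 1 - a * x := by
  have hinv : 1 / (a + s) = a - s := by
    rw [div_eq_iff (by positivity)]
    linear_combination -h
  rw [hinv] at hx
  have hx' := (abs_lt.mp hx).2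
  constructor
  · nlinarith [mul_pos (sub_pos.mpr hx') (show 0 < a + s - x by linarith)]
  · nlinarith [mul_nonneg hs (show 0 ≤ a - s by linarith [abs_nonneg x])]

theorem L_plus_int_iff_conv (m a b : ℤ) (hm : 0 < m) (hns : ¬ IsSquare m)
    (ha : 0 < a) (hb : 0 < b) (hab : a ^ 2 - m * b ^ 2 = 1)
    (hmin : ∀ x y : ℤ, 0 < x → 0 < y →
      (x ^ 2 - m * y ^ 2 = 1 ∨ x ^ 2 - m * y ^ 2 = -1) → a ≤ x ∧ b ≤ y)
    (x : ℚ) (hconv : |(x : ℝ)| < 1 / ((a : ℝ) + (b : ℝ) * Real.sqrt (m : ℝ))) :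
    (∃ k : ℤ, (1 - (a : ℚ) * x) / (1 - 2 * (a : ℚ) * x + x ^ 2) = (k : ℚ)) ↔
      (∃ n : ℕ, x = (Fp a b n : ℚ) / (Fp a b (n + 1) : ℚ)) := by
  constructor
  · rintro ⟨k, hk⟩
    have hmR : (0 : ℝ) ≤ m := by exact_mod_cast hm.le
    obtain ⟨hdR, hnR⟩ := pos_of_abs_lt_inv (a := a) (s := b * √(m : ℝ)) (by exact_mod_cast ha)
      (mul_nonneg (by exact_mod_cast hb.le) (Real.sqrt_nonneg _))
      (by
        rw [mul_pow, Real.sq_sqrt hmR, mul_comm]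
        exact_mod_cast hab) hconv
    have hd : 0 < 1 - 2 * (a : ℚ) * x + x ^ 2 := by exact_mod_cast hdR
    have hn : 0 < 1 - (a : ℚ) * x := by exact_mod_cast hnR
    have hq : (0 : ℚ) < x.den := by exact_mod_cast x.den_pos
    have hxq : x * x.den = x.num := Rat.mul_den_eq_num x
    have hD : 0 < (x.den : ℤ) ^ 2 - 2 * a * x.num * x.den + x.num ^ 2 := by
      have := mul_pos hd (pow_pos hq 2)
      rw [← @Int.cast_pos ℚ]
      push_cast
      rw [← hxq]
      linear_combination this
    have hN : 0 < (x.den : ℤ) - a * x.num := by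
      have := mul_pos hn hq
      rw [← @Int.cast_pos ℚ]
      push_cast
      rw [← hxq]
      linear_combination this
    have hdvd : (x.den : ℤ) ^ 2 - 2 * a * x.num * x.den + x.num ^ 2 ∣
        x.den * (x.den - a * x.num) := by
      refine ⟨k, ?_⟩
      rw [div_eq_iff hd.ne'] at hk
      rw [← @Int.cast_inj ℚ]
      push_cast
      rw [← hxq]
      linear_combination (x.den : ℚ) ^ 2 * hk
    obtain ⟨n, hp, hq'⟩ := exists_eq_div_Fp_of_dvd hm ha hb hab
      (fun u v hu hv huv => (hmin u v hu hv (Or.inl huv)).1)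
      (Rat.isCoprime_num_den x) (by exact_mod_cast x.den_pos) hD hN hdvd
    refine ⟨n, ?_⟩
    have hbQ : (b : ℚ) ≠ 0 := by exact_mod_cast hb.ne'
    rw [← hp, ← hq']
    push_cast
    rw [mul_div_mul_left _ _ hbQ, Rat.num_div_den]
  · rintro ⟨n, rfl⟩
    refine ⟨Fp a 1 (n + 1) * Lp a n, ?_⟩
    obtain ⟨hL, hF⟩ := Lp_pos_Fp_nonneg hm ha hb hab n
    have hF₁ : Fp a b (n + 1) = b * Lp a n + a * Fp a b n := (Lp_Fp_succ hab n).2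
    have hFpos : 0 < Fp a b (n + 1) := by rw [hF₁]; positivity
    have hU : Fp a b (n + 1) = b * Fp a 1 (n + 1) := Fp_eq_mul a b (n + 1)
    have hden : Fp a b (n + 1) ^ 2 - 2 * a * Fp a b n * Fp a b (n + 1) + Fp a b n ^ 2 = b ^ 2 := by
      rw [hF₁]
      linear_combination b ^ 2 * Lp_sq_sub_mul_Fp_sq hab n - Fp a b n ^ 2 * hab
    have hnum : Fp a b (n + 1) * (Fp a b (n + 1) - a * Fp a b n) =
        b ^ 2 * (Fp a 1 (n + 1) * Lp a n) := by
      linear_combination Fp a b (n + 1) * hF₁ + b * Lp a n * hU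
    have hFQ : (Fp a b (n + 1) : ℚ) ≠ 0 := by exact_mod_cast hFpos.ne'
    have hbQ : (b : ℚ) ≠ 0 := by exact_mod_cast hb.ne'
    qify at hden hnum
    have hden' : 1 - 2 * (a : ℚ) * (Fp a b n / Fp a b (n + 1)) +
        ((Fp a b n : ℚ) / Fp a b (n + 1)) ^ 2 = b ^ 2 / (Fp a b (n + 1) : ℚ) ^ 2 := by
      rw [← hden]
      field_simp
    rw [hden', div_eq_iff (by positivity)]
    push_cast
    field_simp
    linear_combination hnum
end
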